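/- Let G be a finite connected simple graph with vertex labeling l : V(G) → ℝ≥0 and let d_l be the distance generated by G(l). Then d_l is an ultrametric on V(G) if and only if l is non-degenerate, i.e., max{l(u), l(v)} > 0 holds for every edge {u,v} ∈ E(G). -/

import Mathlib

open Classical in
/-- The distance `d_l` generated by a labeled graph `G(l)`:
`d_l x x = 0` and, for `x ≠ y`,
`d_l x y = inf over paths P joining x and y of (max_{v ∈ V(P)} l v)`. -/
noncomputable def labelDist {V : Type*} (G : SimpleGraph V) (l : V → NNReal)
    (x y : V) : NNReal :=
  if x = y then 0
  else ⨅ p : {p : G.Walk x y // p.IsPath}, (p.1.support.map l).foldr max 0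

lemma List.foldr_max_zero_le_iff (L : List NNReal) (r : NNReal) :
    L.foldr max 0 ≤ r ↔ ∀ a ∈ L, a ≤ r := by
  induction L with
  | nil => simp
  | cons a L ih => simp [ih]

lemma SimpleGraph.finite_isPath {V : Type*} [Fintype V] (G : SimpleGraph V) (x y : V) :
    Finite {p : G.Walk x y // p.IsPath} := by
  classical
  exact inferInstanceAs (Finite (G.Path x y))

lemma labelDist_le_iff {V : Type*} [Fintype V] {G : SimpleGraph V} (hc : G.Connected)
    (l : V → NNReal) {x y : V} {r : NNReal} :
    labelDist G l x y ≤ r ↔ x = y ∨ ∃ p : G.Walk x y, ∀ v ∈ p.support, l v ≤ r := by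
  classical
  by_cases hxy : x = y
  · simp [labelDist, hxy]
  have := G.finite_isPath x y
  obtain ⟨q, hq⟩ := (hc.preconnected x y).exists_isPath
  have : Nonempty {p : G.Walk x y // p.IsPath} := ⟨⟨q, hq⟩⟩
  simp only [labelDist, hxy, if_false, false_or]
  constructor
  · intro h
    obtain ⟨p, hp⟩ := exists_eq_ciInf_of_finite
      (f := fun p : {p : G.Walk x y // p.IsPath} => (p.1.support.map l).foldr max 0)
    rw [← hp, List.foldr_max_zero_le_iff] at h
    exact ⟨p.1, fun v hv => h _ (List.mem_map_of_mem hv)⟩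
  · rintro ⟨p, hp⟩
    refine (ciInf_le (OrderBot.bddBelow _) ⟨p.bypass, p.bypass_isPath⟩).trans ?_
    rw [List.foldr_max_zero_le_iff]
    simpa using fun v hv => hp v (p.support_bypass_subset_support hv)

lemma labelDist_comm {V : Type*} [Fintype V] {G : SimpleGraph V} (hc : G.Connected)
    (l : V → NNReal) (x y : V) : labelDist G l x y = labelDist G l y x := by
  have h : ∀ x y, labelDist G l x y ≤ labelDist G l y x := fun x y => by
    rw [labelDist_le_iff hc]
    rcases (labelDist_le_iff hc l).1 (le_refl (labelDist G l y x)) with h | ⟨p, hp⟩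
    · exact Or.inl h.symm
    · exact Or.inr ⟨p.reverse, by simpa using hp⟩
  exact (h x y).antisymm (h y x)

lemma labelDist_le_max {V : Type*} [Fintype V] {G : SimpleGraph V} (hc : G.Connected)
    (l : V → NNReal) (x y z : V) :
    labelDist G l x y ≤ max (labelDist G l x z) (labelDist G l z y) := by
  rcases (labelDist_le_iff hc l).1 (le_refl (labelDist G l x z)) with rfl | ⟨p, hp⟩
  · exact le_max_right _ _
  rcases (labelDist_le_iff hc l).1 (le_refl (labelDist G l z y)) with rfl | ⟨q, hq⟩
  · exact le_max_left _ _
  refine (labelDist_le_iff hc l).2 (Or.inr ⟨p.append q, fun v hv => ?_⟩)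
  rcases SimpleGraph.Walk.mem_support_append_iff p q |>.1 hv with hv | hv
  · exact (hp v hv).trans (le_max_left _ _)
  · exact (hq v hv).trans (le_max_right _ _)

/-- For a finite connected labeled graph `G(l)`, the distance
`d_l` is an ultrametric on `V(G)` iff the labeling `l` is non-degenerate,
i.e. `max {l u, l v} > 0` for every edge `{u,v} ∈ E(G)`. -/
theorem labelDist_ultrametric_iff_nondegenerate {V : Type*} [Fintype V]
    (G : SimpleGraph V) (hc : G.Connected) (l : V → NNReal) :
    ((∀ x y, labelDist G l x y = labelDist G l y x) ∧
     (∀ x y, labelDist G l x y = 0 ↔ x = y) ∧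
     (∀ x y z, labelDist G l x y ≤ max (labelDist G l x z) (labelDist G l z y)))
      ↔ ∀ u v : V, G.Adj u v → 0 < max (l u) (l v) := by
  constructor
  · rintro ⟨-, h, -⟩ u v huv
    by_contra! hle
    refine huv.ne ((h u v).1 (le_zero_iff.1 ((labelDist_le_iff hc l).2 (Or.inr ⟨huv.toWalk, ?_⟩))))
    simpa using hle
  · intro h
    refine ⟨labelDist_comm hc l, fun x y => ⟨fun hd => ?_, fun hxy => by simp [labelDist, hxy]⟩,
      labelDist_le_max hc l⟩
    rcases (labelDist_le_iff hc l).1 hd.le with hxy | ⟨p, hp⟩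
    · exact hxy
    cases p with
    | nil => rfl
    | cons huv q =>
      refine absurd (h _ _ huv) (not_lt.2 (max_le (hp _ ?_) (hp _ ?_))) <;> simp
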